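/- Let (λ, u) satisfy a(u,w) = −λ⟨u,w⟩ for all w ∈ H^1(Ω) and (λ*, u*) satisfy a(w, u*) = −conj(λ*)⟨w, u*⟩ for all w ∈ H^1(Ω), with λ = conj(λ*). Then for any v, v* ∈ H^1(Ω) with ⟨v, v*⟩ ≠ 0, the generalized Rayleigh quotient satisfies the identity: −a(v, v*)/⟨v, v*⟩ − λ = −a(v − u, v* − u*)/⟨v, v*⟩ − λ⟨v − u, v* − u*⟩/⟨v, v*⟩. -/

import Mathlib

noncomputable section

/-- Lemma 4.1: generalized Rayleigh quotient identity.
Abstract setting: `V` stands for `H¹(Ω)` on the bounded polygon `Ω ⊂ ℝ²`;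
`a u v = (∇u,∇v) − k²(nu,v)` and `bdry u v = ⟨u,v⟩ = ∫_{∂Ω} u v̄ ds`, both
sesquilinear (here only additivity in each argument is needed).
Let `(λ, u)` satisfy `a(u,w) = −λ⟨u,w⟩` for all `w ∈ H¹(Ω)` and `(λ*, u*)`
satisfy `a(w,u*) = −conj(λ*)⟨w,u*⟩` for all `w ∈ H¹(Ω)`, with `λ = conj(λ*)`.
Then for any `v, v* ∈ H¹(Ω)` with `⟨v, v*⟩ ≠ 0`:
`−a(v,v*)/⟨v,v*⟩ − λ = −a(v−u, v*−u*)/⟨v,v*⟩ − λ⟨v−u, v*−u*⟩/⟨v,v*⟩`. -/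
theorem rayleigh_quotient_identity
    (V : Type*) [AddCommGroup V] [Module ℂ V]
    (a bdry : V → V → ℂ)
    (ha1 : ∀ u w v : V, a (u - w) v = a u v - a w v)
    (ha2 : ∀ v u w : V, a v (u - w) = a v u - a v w)
    (hb1 : ∀ u w v : V, bdry (u - w) v = bdry u v - bdry w v)
    (hb2 : ∀ v u w : V, bdry v (u - w) = bdry v u - bdry v w)
    (lam lamStar : ℂ) (u uStar : V)
    (hu : ∀ w : V, a u w = -lam * bdry u w)
    (huStar : ∀ w : V, a w uStar = -(starRingEnd ℂ) lamStar * bdry w uStar)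
    (hconj : lam = (starRingEnd ℂ) lamStar)
    (v vStar : V) (hv : bdry v vStar ≠ 0) :
    -(a v vStar) / bdry v vStar - lam =
      -(a (v - u) (vStar - uStar)) / bdry v vStar -
        lam * (bdry (v - u) (vStar - uStar) / bdry v vStar) := by
  have huStar' : ∀ w : V, a w uStar = -lam * bdry w uStar := by
    rw [hconj]
    exact huStar
  simp only [ha1, ha2, hb1, hb2, hu, huStar']
  field_simp
  ring
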